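/- In a multi-player perfect-information game with probabilistic transitions, countable state space, nonempty finite action sets, and bounded continuous payoff functions: (a) every action is optimal in the limit game G^∞, i.e. for every state s ∈ S^∞ and every action a ∈ A^∞(s), v^∞_{i(s)}(s) = ∑_{z∈S(s,a)} q(s,a)(z)·v^∞_{i(s)}(z); and (b) for every strategy profile τ that plays only actions of G^∞ (i.e. τ_{i(s)}(s) ∈ A^∞(s) for every s ∈ S^∞), every player i ∈ N, and every state s ∈ S^∞, one has u_i(τ|s) ≥ v^∞_i(s). -/

import Mathlib

open MeasureTheory

/-- A multi-player perfect-information game with probabilistic transitions: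
a set of players `N`, a state space `S` with initial state `init`, a controlling
player `ctrl s` and a nonempty finite action set `act s` for every state `s`, and
a transition probability measure `q s a` for every state `s` and action `a`.
The supports of the transition measures are mutually disjoint and every state is
reachable from the initial state, so every state is reached from `init` via
exactly one finite history (states correspond bijectively to histories). -/
structure PGame (N S A : Type*) where
  init : S
  ctrl : S → N
  act : S → Finset A
  act_nonempty : ∀ s, (act s).Nonempty
  q : S → A → PMF S
  unique_pred : ∀ z s a s' a', a ∈ act s → a' ∈ act s' →
    z ∈ (q s a).support → z ∈ (q s' a').support → s = s' ∧ a = a'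
  init_not_succ : ∀ s a, a ∈ act s → init ∉ (q s a).support
  reach : ∀ z, Relation.ReflTransGen (fun s t => ∃ a ∈ act s, t ∈ (q s a).support) init z

namespace PGame

variable {N S A : Type*} (G : PGame N S A)

/-- A play: an infinite alternating sequence of states and actions, starting at the
initial state, choosing legal actions and moving to successor states. -/
def IsPlay (p : ℕ → S × A) : Prop :=
  (p 0).1 = G.init ∧
    ∀ m, (p m).2 ∈ G.act (p m).1 ∧ (p (m + 1)).1 ∈ (G.q (p m).1 (p m).2).support

/-- The set of plays of the game. -/
def Play : Type _ := { p : ℕ → S × A // G.IsPlay p }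

/-- The set of plays carries the topology generated by the cylinder sets, i.e. the
topology induced by the product of the discrete topologies. -/
instance : TopologicalSpace G.Play :=
  letI : TopologicalSpace S := ⊥
  letI : TopologicalSpace A := ⊥
  inferInstanceAs (TopologicalSpace { p : ℕ → S × A // G.IsPlay p })

/-- The Borel σ-algebra on plays. -/
instance : MeasurableSpace G.Play := borel G.Play

/-- A strategy of player `i`: a choice of a legal action in every state controlled
by `i`. -/
def Strat (i : N) : Type _ := { f : S → A // ∀ s, G.ctrl s = i → f s ∈ G.act s }

/-- A strategy profile. -/
def Profile : Type _ := ∀ i : N, G.Strat i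

/-- The profile `σ` with player `i`'s strategy replaced by `τi`. -/
noncomputable def comb (i : N) (τi : G.Strat i) (σ : G.Profile) : G.Profile :=
  haveI := Classical.decEq N
  Function.update σ i τi

/-- The action that profile `σ` plays in state `s`. -/
def playFun (σ : G.Profile) (s : S) : A := (σ (G.ctrl s)).1 s

/-- The cylinder set of plays agreeing with the play `p0` on the first `n`
coordinates. -/
def cylSet (p0 : G.Play) (n : ℕ) : Set G.Play := { p : G.Play | ∀ m < n, p.1 m = p0.1 m }

open Classical in
/-- `μ` is the family of Borel probability measures on plays induced by the strategy
profiles via the Ionescu–Tulcea construction applied to `q`; it is uniquely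
characterized by the probabilities it assigns to the cylinder sets: actions are
chosen deterministically according to the profile and states are drawn from the
transition probabilities. -/
def IsInducedMeasure (μ : G.Profile → Measure G.Play) : Prop :=
  (∀ σ, IsProbabilityMeasure (μ σ)) ∧
    ∀ (σ : G.Profile) (p0 : G.Play) (n : ℕ),
      μ σ (G.cylSet p0 n) =
        ∏ m ∈ Finset.range n,
          ((if (p0.1 m).2 = G.playFun σ (p0.1 m).1 then 1 else 0) *
            (if m + 1 < n then G.q (p0.1 m).1 (p0.1 m).2 ((p0.1 (m + 1)).1) else 1))

/-- Expected payoff of player `i` under the profile `σ`: the integral of `u i`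
against the induced measure. -/
noncomputable def epay (μ : G.Profile → Measure G.Play) (u : N → G.Play → ℝ)
    (σ : G.Profile) (i : N) : ℝ :=
  ∫ p, u i p ∂(μ σ)

/-- Nash equilibrium: no player can improve his expected payoff by a unilateral
deviation. -/
def IsNash (μ : G.Profile → Measure G.Play) (u : N → G.Play → ℝ) (σ : G.Profile) : Prop :=
  ∀ (i : N) (τi : G.Strat i), G.epay μ u (G.comb i τi σ) i ≤ G.epay μ u σ i

/-- Secure equilibrium: a Nash equilibrium such that no player `i` has a deviation
keeping his own expected payoff equal, making all opponents weakly worse off, and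
making some opponent strictly worse off. -/
def IsSecure (μ : G.Profile → Measure G.Play) (u : N → G.Play → ℝ) (σ : G.Profile) : Prop :=
  G.IsNash μ u σ ∧
    ¬ ∃ (i : N) (τi : G.Strat i),
        G.epay μ u (G.comb i τi σ) i = G.epay μ u σ i ∧
        (∀ j : N, j ≠ i → G.epay μ u (G.comb i τi σ) j ≤ G.epay μ u σ j) ∧
        (∃ k : N, k ≠ i ∧ G.epay μ u (G.comb i τi σ) k < G.epay μ u σ k)

/-- One-step successor relation between states. -/
def step (s t : S) : Prop := ∃ a ∈ G.act s, t ∈ (G.q s a).support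

/-- The set of plays that pass through the state `s` (i.e. the plays extending the
unique history from the initial state to `s`). -/
def through (s : S) : Set G.Play := { p : G.Play | ∃ n, (p.1 n).1 = s }

/-- `E` is the family of subgame expected payoffs: `E σ s i` is the expected payoff
`u_i(σ|s)` of player `i` in the subgame `G(s)` starting from state `s`, under the
profile `σ`.  It is characterized as follows: `E σ s i` only depends on the actions
of `σ` in the subtree rooted at `s`, and for any profile `τ` agreeing with `σ`
there, the integral of `u_i` over the set of plays through `s` under the measure
induced by `τ` equals `E σ s i` times the probability of reaching `s` under `τ`. -/
def IsSubgamePayoff (μ : G.Profile → Measure G.Play) (u : N → G.Play → ℝ)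
    (E : G.Profile → S → N → ℝ) : Prop :=
  ∀ (σ τ : G.Profile) (s : S) (i : N),
    (∀ z, Relation.ReflTransGen G.step s z → G.playFun τ z = G.playFun σ z) →
    ∫ p in G.through s, u i p ∂(μ τ) = E σ s i * (μ τ (G.through s)).toReal
/-- One-step successor relation using only actions in the restricted action sets
`B`. -/
def stepIn (B : S → Set A) (s t : S) : Prop := ∃ a ∈ B s, t ∈ (G.q s a).support

/-- The value `v_i(s)` for player `i` of the zero-sum subgame from `s` of the game
restricted to the action sets `B`: player `i` maximizes the expectation of `u_i`
over his strategies playing in `B` (on the states reachable from `s` via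
`B`-actions), while the coalition of his opponents jointly minimizes it over their
strategies playing in `B` there. -/
noncomputable def rval (E : G.Profile → S → N → ℝ) (B : S → Set A) (s : S) (i : N) : ℝ :=
  ⨆ τi : { f : G.Strat i //
      ∀ z, Relation.ReflTransGen (G.stepIn B) s z → G.ctrl z = i → f.1 z ∈ B z },
    ⨅ τo : { g : G.Profile //
      ∀ z, Relation.ReflTransGen (G.stepIn B) s z → G.ctrl z ≠ i → G.playFun g z ∈ B z },
      E (G.comb i τi.1 τo.1) s i

/-- `v_i(s,a) = ∑_{z ∈ S(s,a)} q(s,a)(z) · v_i(z)` in the game restricted to the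
action sets `B`. -/
noncomputable def rvalQ (E : G.Profile → S → N → ℝ) (B : S → Set A)
    (s : S) (a : A) (i : N) : ℝ :=
  ∑' z : S, ((G.q s a) z).toReal * G.rval E B z i

/-- The elimination procedure: `Ak E 0 = A`, and `Ak E (k+1) s` consists of the
actions of `Ak E k s` that are optimal for the controlling player in the game
`G^k` restricted to the action sets `Ak E k`, i.e. such that
`v^k_{i(s)}(s,a) = v^k_{i(s)}(s)`. -/
noncomputable def Ak (E : G.Profile → S → N → ℝ) (k : ℕ) : S → Set A :=
  Nat.rec (motive := fun _ => S → Set A)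
    (fun s => (G.act s : Set A))
    (fun _ B s =>
      { a ∈ B s | G.rvalQ E B s a (G.ctrl s) = G.rval E B s (G.ctrl s) })
    k

/-- `Sk E k` is the state space `S^k` of the game `G^k`: the set of states
reachable from the initial state using only actions in the sets `Ak E k`. -/
def Sk (E : G.Profile → S → N → ℝ) (k : ℕ) : Set S :=
  { z | Relation.ReflTransGen (G.stepIn (G.Ak E k)) G.init z }

/-- `S^∞ = ⋂_k S^k`. -/
def Sinf (E : G.Profile → S → N → ℝ) : Set S := ⋂ k, G.Sk E k

/-- `A^∞(s) = ⋂_k A^k(s)`. -/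
def Ainf (E : G.Profile → S → N → ℝ) (s : S) : Set A := ⋂ k, G.Ak E k s
end PGame
set_option linter.style.haveILetI false

namespace PGame

section Tree

variable {N S A : Type*} (G : PGame N S A)

instance : BorelSpace G.Play := ⟨rfl⟩

theorem play_unique {p p' : ℕ → S × A} (hp : G.IsPlay p) (hp' : G.IsPlay p') :
    ∀ n m, (p n).1 = (p' m).1 → n = m ∧ ∀ k < n, p k = p' k := by
  intro n
  induction n with
  | zero =>
    intro m h
    cases m with
    | zero => exact ⟨rfl, fun k hk => absurd hk (Nat.not_lt_zero k)⟩
    | succ m =>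
      exfalso
      refine G.init_not_succ _ _ (hp'.2 m).1 ?_
      rw [← hp.1, h]
      exact (hp'.2 m).2
  | succ n ih =>
    intro m h
    cases m with
    | zero =>
      exfalso
      refine G.init_not_succ _ _ (hp.2 n).1 ?_
      rw [← hp'.1, ← h]
      exact (hp.2 n).2
    | succ m =>
      have h1 := G.unique_pred _ _ _ _ _ (hp.2 n).1 (hp'.2 m).1 (hp.2 n).2 (h ▸ (hp'.2 m).2)
      obtain ⟨rfl, h2⟩ := ih m h1.1
      refine ⟨rfl, fun k hk => ?_⟩
      rcases Nat.lt_succ_iff_lt_or_eq.mp hk with h3 | rfl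
      · exact h2 k h3
      · exact Prod.ext h1.1 h1.2

/-- a legal infinite continuation -/
def Legal (r : ℕ → S × A) : Prop :=
  ∀ m, (r m).2 ∈ G.act (r m).1 ∧ (r (m + 1)).1 ∈ (G.q (r m).1 (r m).2).support

theorem splice {p : ℕ → S × A} (hp : G.IsPlay p) {r : ℕ → S × A} (hr : G.Legal r) (n : ℕ)
    (h : (p n).1 = (r 0).1) : G.IsPlay (fun m => if m < n then p m else r (m - n)) := by
  constructor
  · rcases Nat.eq_zero_or_pos n with rfl | hn
    · simp only [Nat.lt_irrefl, if_false, Nat.sub_zero]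
      rw [← h]; exact hp.1
    · simp only [hn, if_true]; exact hp.1
  · intro m
    by_cases h1 : m + 1 < n
    · have h2 : m < n := by omega
      simp only [h1, h2, if_true]
      exact hp.2 m
    · by_cases h2 : m < n
      · have h3 : m + 1 = n := by omega
        simp only [h2, if_true, h3, lt_irrefl, if_false, Nat.sub_self]
        refine ⟨(hp.2 m).1, ?_⟩
        rw [← h, ← h3]; exact (hp.2 m).2
      · simp only [h1, h2, if_false]
        have h3 : m + 1 - n = (m - n) + 1 := by omega
        rw [h3]; exact hr _

/-- any relation-preserving walk can be continued legally -/
theorem exists_walk (P : S → Prop) (f : S → A) (hf : ∀ z, P z → f z ∈ G.act z)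
    (hs : ∀ z, P z → ∃ z' ∈ (G.q z (f z)).support, P z') (s : S) (h : P s) :
    ∃ r, G.Legal r ∧ (r 0).1 = s ∧ ∀ m, P (r m).1 ∧ (r m).2 = f (r m).1 := by
  classical
  choose! g hg1 hg2 using hs
  have hP : ∀ m, P (g^[m] s) := by
    intro m
    induction m with
    | zero => exact h
    | succ m ih => rw [Function.iterate_succ_apply']; exact hg2 _ ih
  refine ⟨fun m => (g^[m] s, f (g^[m] s)), fun m => ⟨hf _ (hP m), ?_⟩, rfl, fun m => ⟨hP m, rfl⟩⟩
  simp only [Function.iterate_succ_apply']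
  exact hg1 _ (hP m)

theorem exists_legal (s : S) (a : A) (ha : a ∈ G.act s) : ∃ r, G.Legal r ∧ r 0 = (s, a) := by
  classical
  choose f hf using G.act_nonempty
  obtain ⟨r, h1, h2, h3⟩ := G.exists_walk (fun _ => True) (Function.update f s a)
    (by
      intro z _
      by_cases hz : z = s
      · subst hz; simpa using ha
      · simp [hz, hf z])
    (fun z _ => by
      obtain ⟨z', hz'⟩ := (G.q z (Function.update f s a z)).support_nonempty
      exact ⟨z', hz', trivial⟩) s trivial
  refine ⟨r, h1, Prod.ext h2 ?_⟩
  rw [(h3 0).2, h2]; simp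

theorem exists_play (s : S) : ∀ a ∈ G.act s, ∃ (p : G.Play) (n : ℕ), p.1 n = (s, a) := by
  have := G.reach s
  induction this with
  | refl =>
    intro a ha
    obtain ⟨r, h1, h2⟩ := G.exists_legal _ a ha
    exact ⟨⟨r, by rw [h2], h1⟩, 0, h2⟩
  | @tail t z _ hstep ih =>
    intro b hb
    obtain ⟨a, ha, hz⟩ := hstep
    obtain ⟨p, n, hp⟩ := ih a ha
    obtain ⟨r, h1, h2⟩ := G.exists_legal z b hb
    refine ⟨⟨_, G.splice p.2 (r := fun m => if m = 0 then (t, a) else r (m - 1)) ?_ n ?_⟩, n + 1, ?_⟩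
    · intro m
      cases m with
      | zero => simp [ha, h2, hz]
      | succ m => simpa using h1 m
    · simp [hp]
    · simp [h2]

theorem through_succ {s z : S} {a : A} (ha : a ∈ G.act s) (hz : z ∈ (G.q s a).support)
    {p : G.Play} (hp : p ∈ G.through z) : ∃ n, p.1 n = (s, a) ∧ (p.1 (n + 1)).1 = z := by
  obtain ⟨n, hn⟩ := hp
  cases n with
  | zero =>
    exfalso
    apply G.init_not_succ s a ha
    rw [← p.2.1, hn]; exact hz
  | succ n =>
    have h1 := G.unique_pred _ _ _ _ _ (p.2.2 n).1 ha (p.2.2 n).2 (hn ▸ hz)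
    exact ⟨n, Prod.ext h1.1 h1.2, hn⟩

theorem through_anti {s z : S} {a : A} (ha : a ∈ G.act s) (hz : z ∈ (G.q s a).support) :
    G.through z ⊆ G.through s := fun p hp => by
  obtain ⟨n, hn, _⟩ := G.through_succ ha hz hp
  exact ⟨n, by rw [hn]⟩

theorem through_nonempty (s : S) : (G.through s).Nonempty := by
  obtain ⟨a, ha⟩ := G.act_nonempty s
  obtain ⟨p, n, h⟩ := G.exists_play s a ha
  exact ⟨p, n, by rw [h]⟩

theorem acyclic {s z : S} (h : G.step s z) : ¬ Relation.ReflTransGen G.step z s := by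
  intro hr
  have hsub : ∀ x y, Relation.ReflTransGen G.step x y → G.through y ⊆ G.through x := by
    intro x y hxy
    induction hxy with
    | refl => exact subset_rfl
    | tail _ hst ih =>
      obtain ⟨a, ha, hz⟩ := hst
      exact (G.through_anti ha hz).trans ih
  obtain ⟨p, hp⟩ := G.through_nonempty s
  obtain ⟨m, hm⟩ := hsub _ _ hr hp
  obtain ⟨a, ha, hz⟩ := h
  -- any play through s with action a then z then s again
  have key : ∀ x, Relation.ReflTransGen G.step z x → ∀ (p : G.Play) (n : ℕ), (p.1 n).1 = x →
      ∃ m, m + 1 ≤ n ∧ (p.1 m).1 = s := by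
    intro x hx
    induction hx with
    | refl =>
      intro p n hn
      obtain ⟨k, hk, hk2⟩ := G.through_succ ha hz ⟨n, hn⟩
      have := (G.play_unique p.2 p.2 n (k+1) (hn.trans hk2.symm)).1
      exact ⟨k, by omega, by rw [hk]⟩
    | tail _ hst ih =>
      intro p n hn
      obtain ⟨b, hb, hy⟩ := hst
      obtain ⟨k, hk, hk2⟩ := G.through_succ hb hy ⟨n, hn⟩
      have := (G.play_unique p.2 p.2 n (k+1) (hn.trans hk2.symm)).1
      obtain ⟨j, hj, hj2⟩ := ih p k (by rw [hk])
      exact ⟨j, by omega, hj2⟩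
  obtain ⟨n, hn⟩ := hp
  obtain ⟨j, hj, hj2⟩ := key s hr p n hn
  have := (G.play_unique p.2 p.2 n j (hn.trans hj2.symm)).1
  omega

theorem measurableSet_through (s : S) : MeasurableSet (G.through s) := by
  apply IsOpen.measurableSet
  have : G.through s = ⋃ n, {p : G.Play | (p.1 n).1 = s} := by
    ext p; simp [through]
  rw [this]
  refine isOpen_iUnion fun n => ?_
  letI : TopologicalSpace S := ⊥
  letI : TopologicalSpace A := ⊥
  haveI : DiscreteTopology S := ⟨rfl⟩
  have hc : Continuous (fun p : G.Play => (p.1 n).1) :=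
    continuous_fst.comp ((continuous_apply n).comp continuous_subtype_val)
  exact (isOpen_discrete ({s} : Set S)).preimage hc

theorem exists_cyl {f : G.Play → ℝ} (hf : Continuous f) (p : G.Play) {ε : ℝ} (hε : 0 < ε) :
    ∃ n, ∀ k, n ≤ k → ∀ p' ∈ G.through (p.1 k).1, |f p' - f p| < ε := by
  letI : TopologicalSpace S := ⊥
  letI : TopologicalSpace A := ⊥
  haveI : DiscreteTopology S := ⟨rfl⟩
  haveI : DiscreteTopology A := ⟨rfl⟩
  have h1 : {p' | |f p' - f p| < ε} ∈ nhds p := by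
    have : Filter.Tendsto (fun p' => |f p' - f p|) (nhds p) (nhds 0) := by
      have h2 : Continuous (fun p' => |f p' - f p|) := by fun_prop
      simpa using h2.tendsto p
    exact this.eventually_lt_const hε
  have h2 : nhds p = Filter.comap (Subtype.val : G.Play → ℕ → S × A) (nhds p.1) :=
    nhds_induced _ _
  rw [h2] at h1
  obtain ⟨t, ht, hts⟩ := Filter.mem_comap.mp h1
  rw [(PiNat.isTopologicalBasis_cylinders (fun _ : ℕ => S × A)).mem_nhds_iff] at ht
  obtain ⟨c, ⟨x, n, rfl⟩, hpc, hct⟩ := ht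
  refine ⟨n, fun k hk p' hp' => hts (hct ?_)⟩
  obtain ⟨m, hm⟩ := hp'
  obtain ⟨rfl, h3⟩ := G.play_unique p'.2 p.2 _ _ hm
  rw [PiNat.mem_cylinder_iff] at hpc ⊢
  intro i hi
  rw [h3 i (by omega), hpc i hi]

end Tree

section Meas

variable {N S A : Type*} (G : PGame N S A)

theorem playFun_mem (σ : G.Profile) (s : S) : G.playFun σ s ∈ G.act s :=
  (σ (G.ctrl s)).2 s rfl

/-- constant profile given by a legal choice of actions -/
def mkProfile (f : S → A) (hf : ∀ s, f s ∈ G.act s) : G.Profile := fun _ => ⟨f, fun s _ => hf s⟩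

theorem playFun_mkProfile (f : S → A) (hf : ∀ s, f s ∈ G.act s) (s : S) :
    G.playFun (G.mkProfile f hf) s = f s := rfl

theorem playFun_comb_self (i : N) (τi : G.Strat i) (σ : G.Profile) {s : S} (h : G.ctrl s = i) :
    G.playFun (G.comb i τi σ) s = τi.1 s := by
  subst h
  have h1 : G.comb (G.ctrl s) τi σ (G.ctrl s) = τi :=
    @Function.update_self N G.Strat (Classical.decEq N) (G.ctrl s) τi σ
  unfold playFun
  rw [h1]

theorem playFun_comb_ne (i : N) (τi : G.Strat i) (σ : G.Profile) {s : S} (h : G.ctrl s ≠ i) :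
    G.playFun (G.comb i τi σ) s = G.playFun σ s := by
  have h1 : G.comb i τi σ (G.ctrl s) = σ (G.ctrl s) :=
    @Function.update_of_ne N G.Strat (Classical.decEq N) (G.ctrl s) i h τi σ
  unfold playFun
  rw [h1]

variable {μ : G.Profile → Measure G.Play}

theorem null_wrong (hμ : G.IsInducedMeasure μ) (τ : G.Profile) (s : S) :
    μ τ {p | ∃ n, (p.1 n).1 = s ∧ (p.1 n).2 ≠ G.playFun τ s} = 0 := by
  haveI : Nonempty G.Play := ⟨(G.through_nonempty s).some⟩
  choose! P n hP using G.exists_play s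
  have hsub : {p : G.Play | ∃ n, (p.1 n).1 = s ∧ (p.1 n).2 ≠ G.playFun τ s} ⊆
      ⋃ b ∈ {b | b ∈ G.act s ∧ b ≠ G.playFun τ s}, G.cylSet (P b) (n b + 1) := by
    rintro p ⟨m, hm, hne⟩
    have hb : (p.1 m).2 ∈ G.act s := hm ▸ (p.2.2 m).1
    simp only [Set.mem_iUnion]
    refine ⟨(p.1 m).2, ⟨hb, hne⟩, ?_⟩
    have hPb := hP _ hb
    obtain ⟨h1, h2⟩ := G.play_unique p.2 (P (p.1 m).2).2 m (n (p.1 m).2) (by rw [hPb, hm])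
    intro k hk
    rcases Nat.lt_succ_iff_lt_or_eq.mp hk with h3 | h3
    · exact h2 k (by omega)
    · rw [h3, hPb, ← h1]; exact Prod.ext hm rfl
  refine measure_mono_null hsub ?_
  rw [measure_biUnion_null_iff]
  · rintro b ⟨hb, hne⟩
    rw [hμ.2, Finset.prod_range_succ, hP b hb]
    simp [hne]
  · exact ((G.act s).finite_toSet.subset (fun b hb => hb.1)).countable

theorem meas_through_cyl (hμ : G.IsInducedMeasure μ) (τ : G.Profile) (s : S) (p0 : G.Play) (n : ℕ)
    (h : p0.1 n = (s, G.playFun τ s)) : μ τ (G.through s) = μ τ (G.cylSet p0 (n + 1)) := by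
  apply le_antisymm
  · have : G.through s ⊆ G.cylSet p0 (n+1) ∪
        {p | ∃ n, (p.1 n).1 = s ∧ (p.1 n).2 ≠ G.playFun τ s} := by
      rintro p ⟨m, hm⟩
      by_cases h1 : (p.1 m).2 = G.playFun τ s
      · left
        obtain ⟨h2, h3⟩ := G.play_unique p.2 p0.2 m n (by rw [h, hm])
        subst h2
        intro k hk
        rcases Nat.lt_succ_iff_lt_or_eq.mp hk with h4 | rfl
        · exact h3 k h4
        · rw [h]; exact Prod.ext hm h1
      · right; exact ⟨m, hm, h1⟩
    calc _ ≤ _ := measure_mono this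
      _ ≤ _ := measure_union_le _ _
      _ = _ := by rw [G.null_wrong hμ, add_zero]
  · refine measure_mono fun p hp => ⟨n, ?_⟩
    rw [hp n (Nat.lt_succ_self n), h]

theorem meas_succ (hμ : G.IsInducedMeasure μ) (τ : G.Profile) (s z : S) (hz : z ∈ (G.q s (G.playFun τ s)).support) :
    μ τ (G.through z) = μ τ (G.through s) * G.q s (G.playFun τ s) z := by
  obtain ⟨p0, m, hm⟩ := G.exists_play z _ (G.playFun_mem τ z)
  obtain ⟨n, hn, hn2⟩ := G.through_succ (G.playFun_mem τ s) hz (p := p0) ⟨m, by rw [hm]⟩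
  have := (G.play_unique p0.2 p0.2 m (n+1) (by rw [hn2, hm])).1
  subst this
  rw [G.meas_through_cyl hμ τ z p0 _ hm, G.meas_through_cyl hμ τ s p0 _ hn, hμ.2, hμ.2,
    Finset.prod_range_succ, Finset.prod_range_succ, Finset.prod_range_succ, hm, hn]
  simp only [if_true, lt_irrefl, if_false, mul_one, one_mul, Nat.lt_succ_self]
  congr 1
  refine Finset.prod_congr rfl fun k hk => ?_
  have := Finset.mem_range.mp hk
  rw [if_pos (show k + 1 < n + 1 + 1 by omega), if_pos (show k + 1 < n + 1 by omega)]

theorem exists_pos (hμ : G.IsInducedMeasure μ) (s : S) : ∀ σ : G.Profile, ∃ τ : G.Profile,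
    (∀ z, Relation.ReflTransGen G.step s z → G.playFun τ z = G.playFun σ z) ∧
    μ τ (G.through s) ≠ 0 := by
  classical
  have := G.reach s
  induction this with
  | refl =>
    intro σ
    refine ⟨σ, fun _ _ => rfl, ?_⟩
    have : G.through G.init = Set.univ := Set.eq_univ_of_forall fun p => ⟨0, p.2.1⟩
    haveI := hμ.1 σ
    rw [‹G.through G.init = Set.univ›, measure_univ]; exact one_ne_zero
  | @tail t z _ hst ih =>
    intro σ
    obtain ⟨a, ha, hz⟩ := hst
    obtain ⟨τ, h1, h2⟩ := ih (G.mkProfile (Function.update (G.playFun σ) t a) (by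
      intro x
      by_cases hx : x = t
      · subst hx; simpa using ha
      · simpa [hx] using G.playFun_mem σ x))
    have hta : G.playFun τ t = a := by
      rw [h1 t .refl, playFun_mkProfile]; simp
    refine ⟨τ, fun x hx => ?_, ?_⟩
    · rw [h1 x (.head ⟨a, ha, hz⟩ hx), playFun_mkProfile, Function.update_of_ne]
      rintro rfl
      exact G.acyclic ⟨a, ha, hz⟩ hx
    · rw [G.meas_succ hμ τ t z (hta ▸ hz), hta]
      exact mul_ne_zero h2 ((PMF.mem_support_iff _ _).mp hz)

variable {u : N → G.Play → ℝ} {E : G.Profile → S → N → ℝ}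

theorem integrable_u (hμ : G.IsInducedMeasure μ)
    (hu_bdd : ∀ i : N, ∃ C : ℝ, ∀ p : G.Play, |u i p| ≤ C)
    (hu_cont : ∀ i : N, Continuous (u i)) (τ : G.Profile) (i : N) : Integrable (u i) (μ τ) := by
  haveI := hμ.1 τ
  obtain ⟨C, hC⟩ := hu_bdd i
  exact Integrable.of_bound (hu_cont i).measurable.aestronglyMeasurable C
    (Filter.Eventually.of_forall hC)

theorem E_within (hμ : G.IsInducedMeasure μ)
    (hu_bdd : ∀ i : N, ∃ C : ℝ, ∀ p : G.Play, |u i p| ≤ C)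
    (hu_cont : ∀ i : N, Continuous (u i))
    (hE : G.IsSubgamePayoff μ u E) (σ : G.Profile) (s : S) (i : N) (a b : ℝ)
    (h : ∀ p ∈ G.through s, a ≤ u i p ∧ u i p ≤ b) : a ≤ E σ s i ∧ E σ s i ≤ b := by
  obtain ⟨τ, h1, h2⟩ := G.exists_pos hμ s σ
  have h3 := hE σ τ s i h1
  haveI := hμ.1 τ
  have hintg := G.integrable_u hμ hu_bdd hu_cont τ i
  have hpos : 0 < (μ τ (G.through s)).toReal := ENNReal.toReal_pos h2 (measure_ne_top _ _)
  have ha : a * (μ τ (G.through s)).toReal ≤ ∫ p in G.through s, u i p ∂(μ τ) := by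
    have := setIntegral_mono_on (μ := μ τ) (f := fun _ => a) (integrable_const a).integrableOn
      hintg.integrableOn (G.measurableSet_through s) (fun p hp => (h p hp).1)
    simpa [Measure.real, mul_comm] using this
  have hb : ∫ p in G.through s, u i p ∂(μ τ) ≤ b * (μ τ (G.through s)).toReal := by
    have := setIntegral_mono_on (μ := μ τ) (g := fun _ => b) hintg.integrableOn
      (integrable_const b).integrableOn
      (G.measurableSet_through s) (fun p hp => (h p hp).2)
    simpa [Measure.real, mul_comm] using this
  rw [h3] at ha hb
  exact ⟨le_of_mul_le_mul_right ha hpos, le_of_mul_le_mul_right hb hpos⟩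

theorem E_step [Countable S] (hμ : G.IsInducedMeasure μ)
    (hu_bdd : ∀ i : N, ∃ C : ℝ, ∀ p : G.Play, |u i p| ≤ C)
    (hu_cont : ∀ i : N, Continuous (u i))
    (hE : G.IsSubgamePayoff μ u E) (σ : G.Profile) (s : S) (i : N) :
    E σ s i = ∑' z, (G.q s (G.playFun σ s) z).toReal * E σ z i := by
  obtain ⟨τ, h1, h2⟩ := G.exists_pos hμ s σ
  have h3 := hE σ τ s i h1
  haveI := hμ.1 τ
  have hintg := G.integrable_u hμ hu_bdd hu_cont τ i
  have hpos : 0 < (μ τ (G.through s)).toReal := ENNReal.toReal_pos h2 (measure_ne_top _ _)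
  have hτ := h1 s .refl
  have hae : G.through s =ᵐ[μ τ]
      (⋃ z : (G.q s (G.playFun σ s)).support, G.through z.1 : Set G.Play) := by
    refine (ae_le_set.mpr ?_).antisymm (LE.le.eventuallyLE ?_)
    · refine measure_mono_null ?_ (G.null_wrong hμ τ s)
      rintro p ⟨⟨n, hn⟩, hp⟩
      refine ⟨n, hn, fun h => hp ?_⟩
      rw [Set.mem_iUnion]
      refine ⟨⟨(p.1 (n+1)).1, ?_⟩, n + 1, rfl⟩
      have := (p.2.2 n).2
      rwa [h, hn, hτ] at this
    · exact Set.iUnion_subset fun z => G.through_anti (G.playFun_mem σ s) z.2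
  rw [setIntegral_congr_set hae, integral_iUnion (s := fun z : (G.q s (G.playFun σ s)).support => G.through z.1)
    (fun z => G.measurableSet_through z.1) ?_
    hintg.integrableOn] at h3
  · have h4 : ∀ z : (G.q s (G.playFun σ s)).support, ∫ p in G.through z.1, u i p ∂(μ τ) =
        (μ τ (G.through s)).toReal * ((G.q s (G.playFun σ s) z).toReal * E σ z i) := by
      intro z
      rw [hE σ τ z i (fun x hx => h1 x (.head ⟨_, G.playFun_mem σ s, z.2⟩ hx)),
        G.meas_succ hμ τ s z (by rw [hτ]; exact z.2), hτ, ENNReal.toReal_mul]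
      ring
    rw [tsum_congr h4, tsum_mul_left, mul_comm] at h3
    have h5 := mul_right_cancel₀ hpos.ne' h3
    rw [← h5]
    refine tsum_subtype_eq_of_support_subset
      (f := fun z => (G.q s (G.playFun σ s) z).toReal * E σ z i) ?_
    intro z hz
    rw [PMF.mem_support_iff]
    intro h0
    simp [h0] at hz
  · intro z z' hne
    refine Set.disjoint_left.mpr fun p hp hp' => hne ?_
    obtain ⟨n, hn, hn2⟩ := G.through_succ (G.playFun_mem σ s) z.2 hp
    obtain ⟨m, hm, hm2⟩ := G.through_succ (G.playFun_mem σ s) z'.2 hp'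
    have := (G.play_unique p.2 p.2 n m (by rw [hn, hm])).1
    subst this
    exact Subtype.ext (hn2.symm.trans hm2)

end Meas

end PGame

namespace PGame

section Values

open Filter Topology

variable {N S A : Type*} (G : PGame N S A)

/-- expected value of `w` after playing `a` at `s` -/
noncomputable def Q (w : S → ℝ) (s : S) (a : A) : ℝ := ∑' z, (G.q s a z).toReal * w z

theorem q_hasSum (s : S) (a : A) : HasSum (fun z => (G.q s a z).toReal) 1 := by
  have := ENNReal.hasSum_toReal (f := fun z => G.q s a z)
    (by rw [PMF.tsum_coe]; exact ENNReal.one_ne_top)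
  rwa [← ENNReal.tsum_toReal_eq (fun z => PMF.apply_ne_top _ z), PMF.tsum_coe,
    ENNReal.toReal_one] at this

variable {G} in
theorem q_summable {w : S → ℝ} {C : ℝ} (hC : ∀ z, |w z| ≤ C) (s : S) (a : A) :
    Summable (fun z => (G.q s a z).toReal * w z) := by
  refine Summable.of_norm_bounded (g := fun z => (G.q s a z).toReal * C)
    ((G.q_hasSum s a).summable.mul_right C) fun z => ?_
  rw [norm_mul, Real.norm_of_nonneg ENNReal.toReal_nonneg]
  exact mul_le_mul_of_nonneg_left (hC z) ENNReal.toReal_nonneg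

variable {G} in
theorem Q_mono {w w' : S → ℝ} {C C' : ℝ} (hC : ∀ z, |w z| ≤ C) (hC' : ∀ z, |w' z| ≤ C')
    (s : S) (a : A) (h : ∀ z ∈ (G.q s a).support, w z ≤ w' z) : G.Q w s a ≤ G.Q w' s a := by
  refine Summable.tsum_le_tsum (fun z => ?_) (q_summable hC s a) (q_summable hC' s a)
  by_cases hz : z ∈ (G.q s a).support
  · exact mul_le_mul_of_nonneg_left (h z hz) ENNReal.toReal_nonneg
  · rw [PMF.mem_support_iff, not_not] at hz
    simp [hz]

theorem Q_const (c : ℝ) (s : S) (a : A) : G.Q (fun _ => c) s a = c := by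
  unfold Q
  rw [tsum_mul_right, (G.q_hasSum s a).tsum_eq, one_mul]

variable {G} in
theorem Q_sub {w w' : S → ℝ} {C C' : ℝ} (hC : ∀ z, |w z| ≤ C) (hC' : ∀ z, |w' z| ≤ C')
    (s : S) (a : A) : G.Q (fun z => w z - w' z) s a = G.Q w s a - G.Q w' s a := by
  unfold Q
  rw [← (q_summable hC s a).tsum_sub (q_summable hC' s a)]
  exact tsum_congr fun z => by ring

variable {G} in
theorem exists_succ_ge {D : S → ℝ} {C : ℝ} (hC : ∀ z, |D z| ≤ C) (s : S) (a : A)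
    (h : D s ≤ G.Q D s a) : ∃ z ∈ (G.q s a).support, D s ≤ D z := by
  by_contra hcon
  push Not at hcon
  obtain ⟨z0, hz0⟩ := (G.q s a).support_nonempty
  have hpos : 0 < (G.q s a z0).toReal :=
    ENNReal.toReal_pos ((PMF.mem_support_iff _ _).mp hz0) (PMF.apply_ne_top _ _)
  have : G.Q D s a < G.Q (fun _ => D s) s a := by
    refine Summable.tsum_lt_tsum (i := z0) (fun z => ?_)
      (mul_lt_mul_of_pos_left (hcon z0 hz0) hpos) (q_summable hC s a)
      (q_summable (C := |D s|) (fun _ => le_rfl) s a)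
    by_cases hz : z ∈ (G.q s a).support
    · exact mul_le_mul_of_nonneg_left (hcon z hz).le ENNReal.toReal_nonneg
    · rw [PMF.mem_support_iff, not_not] at hz
      simp [hz]
  rw [Q_const] at this
  linarith

/-- a bounded submartingale vanishing along all plays is nonpositive -/
theorem submart_nonpos {D : S → ℝ} {C : ℝ} (hC : ∀ z, |D z| ≤ C)
    (hlim : ∀ (p : G.Play) (ε : ℝ), 0 < ε → ∃ n, ∀ k, n ≤ k → |D (p.1 k).1| < ε)
    (τ : G.Profile) (R : S → Prop)
    (hR : ∀ z, R z → ∀ z' ∈ (G.q z (G.playFun τ z)).support, R z')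
    (hD : ∀ z, R z → D z ≤ G.Q D z (G.playFun τ z)) (s : S) (hs : R s) : D s ≤ 0 := by
  by_contra hpos
  push Not at hpos
  obtain ⟨r, hr, hr0, hrP⟩ := G.exists_walk (fun z => R z ∧ D s ≤ D z) (G.playFun τ)
    (fun z _ => G.playFun_mem τ z)
    (fun z hz => by
      obtain ⟨z', h1, h2⟩ := exists_succ_ge hC z _ (hD z hz.1)
      exact ⟨z', h1, hR z hz.1 z' h1, hz.2.trans h2⟩) s ⟨hs, le_rfl⟩
  obtain ⟨p, n, hp⟩ := G.through_nonempty s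
  obtain ⟨k, hk⟩ := hlim ⟨_, G.splice p.2 hr n (hp.trans hr0.symm)⟩ (D s) hpos
  have h1 := hk (n + k) (by omega)
  simp only [show ¬ (n + k < n) by omega, if_false, Nat.add_sub_cancel_left] at h1
  have h2 := (hrP k).1.2
  rw [abs_lt] at h1
  linarith [h1.2]

/-- `w` lies within the range of `f` on every subgame -/
def Within (f : G.Play → ℝ) (w : S → ℝ) : Prop :=
  ∀ s a b, (∀ p ∈ G.through s, a ≤ f p ∧ f p ≤ b) → a ≤ w s ∧ w s ≤ b

variable {G} in
theorem Within.bdd {f : G.Play → ℝ} {w : S → ℝ} (h : G.Within f w) {C : ℝ}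
    (hC : ∀ p, |f p| ≤ C) (z : S) : |w z| ≤ C :=
  abs_le.mpr (h z (-C) C fun p _ => abs_le.mp (hC p))

variable {G} in
theorem Within.lim {f : G.Play → ℝ} (hf : Continuous f) {w w' : S → ℝ} (h : G.Within f w)
    (h' : G.Within f w') (p : G.Play) (ε : ℝ) (hε : 0 < ε) :
    ∃ n, ∀ k, n ≤ k → |w (p.1 k).1 - w' (p.1 k).1| < ε := by
  obtain ⟨n, hn⟩ := G.exists_cyl hf p (show 0 < ε / 3 by positivity)
  refine ⟨n, fun k hk => ?_⟩
  have key : ∀ p' ∈ G.through (p.1 k).1, f p - ε / 3 ≤ f p' ∧ f p' ≤ f p + ε / 3 := by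
    intro p' hp'
    have := abs_lt.mp (hn k hk p' hp')
    constructor <;> linarith [this.1, this.2]
  have h1 := h _ _ _ key
  have h2 := h' _ _ _ key
  rw [abs_lt]
  constructor <;> linarith [h1.1, h1.2, h2.1, h2.2]

/-- Bellman equation for player `i` in the game restricted to `B` -/
def Bellman (B : S → Set A) (i : N) (w : S → ℝ) : Prop :=
  (∀ z, G.ctrl z = i → (∀ a ∈ B z, G.Q w z a ≤ w z) ∧ ∃ a ∈ B z, G.Q w z a = w z) ∧
  (∀ z, G.ctrl z ≠ i → (∀ a ∈ B z, w z ≤ G.Q w z a) ∧ ∃ a ∈ B z, G.Q w z a = w z)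

theorem exists_bellman {f : G.Play → ℝ} {C : ℝ} (hC : ∀ p, |f p| ≤ C) (B : S → Set A)
    (hB : ∀ z, B z ⊆ G.act z) (hB' : ∀ z, (B z).Nonempty) (i : N) :
    ∃ w, G.Within f w ∧ G.Bellman B i w := by
  classical
  let lo : S → ℝ := fun z => sInf (f '' G.through z)
  let hi : S → ℝ := fun z => sSup (f '' G.through z)
  have hbb : ∀ z, BddBelow (f '' G.through z) := fun z =>
    ⟨-C, by rintro _ ⟨p, _, rfl⟩; exact (abs_le.mp (hC p)).1⟩
  have hba : ∀ z, BddAbove (f '' G.through z) := fun z =>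
    ⟨C, by rintro _ ⟨p, _, rfl⟩; exact (abs_le.mp (hC p)).2⟩
  have hne : ∀ z, (f '' G.through z).Nonempty := fun z => (G.through_nonempty z).image f
  have hlohi : ∀ z, lo z ≤ hi z := fun z => csInf_le_csSup (hne z) (hbb z) (hba z)
  have hloC : ∀ z, -C ≤ lo z := fun z => le_csInf (hne z) (by
    rintro _ ⟨p, _, rfl⟩; exact (abs_le.mp (hC p)).1)
  have hhiC : ∀ z, hi z ≤ C := fun z => csSup_le (hne z) (by
    rintro _ ⟨p, _, rfl⟩; exact (abs_le.mp (hC p)).2)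
  haveI : ∀ z, Fact (lo z ≤ hi z) := fun z => ⟨hlohi z⟩
  haveI : ∀ z, Finite (B z) := fun z => ((G.act z).finite_toSet.subset (hB z)).to_subtype
  haveI : ∀ z, Nonempty (B z) := fun z => (hB' z).to_subtype
  have hbd : ∀ (w : ∀ z, Set.Icc (lo z) (hi z)) z, |(w z : ℝ)| ≤ C := fun w z =>
    abs_le.mpr ⟨(hloC z).trans (w z).2.1, (w z).2.2.trans (hhiC z)⟩
  have hQ : ∀ (w : ∀ z, Set.Icc (lo z) (hi z)) z a, a ∈ B z →
      lo z ≤ G.Q (fun x => w x) z a ∧ G.Q (fun x => w x) z a ≤ hi z := by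
    intro w z a ha
    constructor
    · rw [← G.Q_const (lo z) z a]
      refine Q_mono (fun _ => le_rfl) (hbd w) z a fun z' hz' => ?_
      exact (csInf_le_csInf (hbb z) (hne z')
        (Set.image_mono (G.through_anti (hB z ha) hz'))).trans (w z').2.1
    · rw [← G.Q_const (hi z) z a]
      refine Q_mono (hbd w) (fun _ => le_rfl) z a fun z' hz' => ?_
      exact (w z').2.2.trans (csSup_le_csSup (hba z) (hne z')
        (Set.image_mono (G.through_anti (hB z ha) hz')))
  let T0 : (∀ z, Set.Icc (lo z) (hi z)) → S → ℝ := fun w z =>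
    if G.ctrl z = i then ⨆ a : B z, G.Q (fun x => w x) z a
    else ⨅ a : B z, G.Q (fun x => w x) z a
  have hT0 : ∀ w z, ∃ a ∈ B z, G.Q (fun x => w x) z a = T0 w z := by
    intro w z
    by_cases h : G.ctrl z = i
    · obtain ⟨a, ha⟩ := exists_eq_ciSup_of_finite (f := fun a : B z => G.Q (fun x => w x) z a)
      exact ⟨a, a.2, by simp only [T0, h, if_true]; exact ha⟩
    · obtain ⟨a, ha⟩ := exists_eq_ciInf_of_finite (f := fun a : B z => G.Q (fun x => w x) z a)
      exact ⟨a, a.2, by simp only [T0, h, if_false]; exact ha⟩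
  let T : (∀ z, Set.Icc (lo z) (hi z)) →o (∀ z, Set.Icc (lo z) (hi z)) :=
    { toFun := fun w z => ⟨T0 w z, by
        obtain ⟨a, ha, h⟩ := hT0 w z
        rw [← h]; exact hQ w z a ha⟩
      monotone' := by
        intro w w' hww z
        rw [← Subtype.coe_le_coe]
        have hm : ∀ a : B z, G.Q (fun x => w x) z a ≤ G.Q (fun x => w' x) z a := fun a =>
          Q_mono (G := G) (hbd w) (hbd w') z a fun x _ => hww x
        by_cases h : G.ctrl z = i
        · simp only [T0, h, if_true]
          exact ciSup_mono (Set.finite_range _).bddAbove hm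
        · simp only [T0, h, if_false]
          exact ciInf_mono (Set.finite_range _).bddBelow hm }
  have hfix : ∀ z, T0 (T.lfp) z = (T.lfp z : ℝ) := fun z => by
    conv_rhs => rw [← T.map_lfp]
    rfl
  refine ⟨fun z => (T.lfp z : ℝ), ?_, ?_, ?_⟩
  · intro s a b h
    refine ⟨le_trans (le_csInf (hne s) ?_) (T.lfp s).2.1,
      (T.lfp s).2.2.trans (csSup_le (hne s) ?_)⟩
    · rintro _ ⟨p, hp, rfl⟩; exact (h p hp).1
    · rintro _ ⟨p, hp, rfl⟩; exact (h p hp).2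
  · intro z hz
    refine ⟨fun a ha => ?_, ?_⟩
    · beta_reduce
      rw [← hfix]
      simp only [T0, hz, if_true]
      exact le_ciSup (f := fun a : B z => G.Q (fun x => (T.lfp x : ℝ)) z a)
        (Set.finite_range _).bddAbove ⟨a, ha⟩
    · beta_reduce; rw [← hfix]; exact hT0 _ z
  · intro z hz
    refine ⟨fun a ha => ?_, ?_⟩
    · beta_reduce
      rw [← hfix]
      simp only [T0, hz, if_false]
      exact ciInf_le (f := fun a : B z => G.Q (fun x => (T.lfp x : ℝ)) z a)
        (Set.finite_range _).bddBelow ⟨a, ha⟩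
    · beta_reduce; rw [← hfix]; exact hT0 _ z

/-- The two facts about subgame payoffs used below. -/
structure GoodE (u : N → G.Play → ℝ) (E : G.Profile → S → N → ℝ) : Prop where
  bdd : ∀ i : N, ∃ C : ℝ, ∀ p : G.Play, |u i p| ≤ C
  cont : ∀ i : N, Continuous (u i)
  within : ∀ σ i, G.Within (u i) (fun s => E σ s i)
  one_step : ∀ σ s i, E σ s i = G.Q (fun z => E σ z i) s (G.playFun σ s)

variable {G} {u : N → G.Play → ℝ} {E : G.Profile → S → N → ℝ}

theorem GoodE.le_E (h : G.GoodE u E) {i : N} {w : S → ℝ} (hw : G.Within (u i) w)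
    (τ : G.Profile) (R : S → Prop)
    (hR : ∀ z, R z → ∀ z' ∈ (G.q z (G.playFun τ z)).support, R z')
    (hD : ∀ z, R z → w z ≤ G.Q w z (G.playFun τ z)) (s : S) (hs : R s) : w s ≤ E τ s i := by
  obtain ⟨C, hC⟩ := h.bdd i
  have hb1 := hw.bdd hC
  have hb2 := (h.within τ i).bdd hC
  have := G.submart_nonpos (D := fun z => w z - E τ z i) (C := C + C)
    (fun z => (abs_sub _ _).trans (add_le_add (hb1 z) (hb2 z)))
    (hw.lim (h.cont i) (h.within τ i)) τ R hR (fun z hz => by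
      rw [Q_sub hb1 hb2, ← h.one_step]
      exact sub_le_sub_right (hD z hz) _) s hs
  linarith

theorem GoodE.E_le (h : G.GoodE u E) {i : N} {w : S → ℝ} (hw : G.Within (u i) w)
    (τ : G.Profile) (R : S → Prop)
    (hR : ∀ z, R z → ∀ z' ∈ (G.q z (G.playFun τ z)).support, R z')
    (hD : ∀ z, R z → G.Q w z (G.playFun τ z) ≤ w z) (s : S) (hs : R s) : E τ s i ≤ w s := by
  obtain ⟨C, hC⟩ := h.bdd i
  have hb1 := hw.bdd hC
  have hb2 := (h.within τ i).bdd hC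
  have := G.submart_nonpos (D := fun z => E τ z i - w z) (C := C + C)
    (fun z => (abs_sub _ _).trans (add_le_add (hb2 z) (hb1 z)))
    ((h.within τ i).lim (h.cont i) hw) τ R hR (fun z hz => by
      rw [Q_sub hb2 hb1, ← h.one_step]
      exact sub_le_sub_left (hD z hz) _) s hs
  linarith

theorem GoodE.rval_eq (h : G.GoodE u E) {B : S → Set A} (hB : ∀ z, B z ⊆ G.act z) {i : N} {w : S → ℝ}
    (hw : G.Within (u i) w) (hbel : G.Bellman B i w) :
    (∀ s, G.rval E B s i = w s) ∧
      ∃ τ : G.Profile, (∀ z, G.playFun τ z ∈ B z) ∧ ∀ s, E τ s i = w s := by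
  classical
  have hex : ∀ z, ∃ a ∈ B z, G.Q w z a = w z := fun z => by
    by_cases hz : G.ctrl z = i
    · exact (hbel.1 z hz).2
    · exact (hbel.2 z hz).2
  choose f hfB hfQ using hex
  have hfact : ∀ z, f z ∈ G.act z := fun z => hB z (hfB z)
  obtain ⟨C, hC⟩ := h.bdd i
  have hEb : ∀ σ s, |E σ s i| ≤ C := fun σ s => (h.within σ i).bdd hC s
  refine ⟨fun s => ?_, G.mkProfile f hfact, hfB, fun s => le_antisymm ?_ ?_⟩
  · let fi : { g : G.Strat i // ∀ z, Relation.ReflTransGen (G.stepIn B) s z →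
        G.ctrl z = i → g.1 z ∈ B z } := ⟨⟨f, fun z _ => hfact z⟩, fun z _ _ => hfB z⟩
    let fo : { g : G.Profile // ∀ z, Relation.ReflTransGen (G.stepIn B) s z →
        G.ctrl z ≠ i → G.playFun g z ∈ B z } := ⟨G.mkProfile f hfact, fun z _ _ => hfB z⟩
    haveI : Nonempty { g : G.Strat i // ∀ z, Relation.ReflTransGen (G.stepIn B) s z →
        G.ctrl z = i → g.1 z ∈ B z } := ⟨fi⟩
    haveI : Nonempty { g : G.Profile // ∀ z, Relation.ReflTransGen (G.stepIn B) s z →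
        G.ctrl z ≠ i → G.playFun g z ∈ B z } := ⟨fo⟩
    have hbelow : ∀ τi : G.Strat i, BddBelow (Set.range fun τo : { g : G.Profile //
        ∀ z, Relation.ReflTransGen (G.stepIn B) s z → G.ctrl z ≠ i → G.playFun g z ∈ B z } =>
        E (G.comb i τi τo.1) s i) := fun τi =>
      ⟨-C, by rintro _ ⟨τo, rfl⟩; exact (abs_le.mp (hEb _ s)).1⟩
    have hmem : ∀ (τi : { g : G.Strat i // ∀ z, Relation.ReflTransGen (G.stepIn B) s z →
          G.ctrl z = i → g.1 z ∈ B z })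
        (τo : { g : G.Profile // ∀ z, Relation.ReflTransGen (G.stepIn B) s z →
          G.ctrl z ≠ i → G.playFun g z ∈ B z }) z, Relation.ReflTransGen (G.stepIn B) s z →
        G.playFun (G.comb i τi.1 τo.1) z ∈ B z := by
      intro τi τo z hz
      by_cases hc : G.ctrl z = i
      · rw [playFun_comb_self _ _ _ _ hc]; exact τi.2 z hz hc
      · rw [playFun_comb_ne _ _ _ _ hc]; exact τo.2 z hz hc
    apply le_antisymm
    · refine ciSup_le fun τi => (ciInf_le (hbelow τi.1) fo).trans ?_
      refine h.E_le hw _ (fun z => Relation.ReflTransGen (G.stepIn B) s z)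
        (fun z hz z' hz' => hz.tail ⟨_, hmem τi fo z hz, hz'⟩) (fun z hz => ?_) s .refl
      by_cases hc : G.ctrl z = i
      · exact (hbel.1 z hc).1 _ (hmem τi fo z hz)
      · rw [playFun_comb_ne _ _ _ _ hc]; exact (hfQ z).le
    · refine le_ciSup_of_le ⟨C, ?_⟩ fi (le_ciInf fun τo => ?_)
      · rintro _ ⟨τi, rfl⟩
        exact (ciInf_le (hbelow τi.1) fo).trans (abs_le.mp (hEb _ s)).2
      refine h.le_E hw _ (fun z => Relation.ReflTransGen (G.stepIn B) s z)
        (fun z hz z' hz' => hz.tail ⟨_, hmem fi τo z hz, hz'⟩) (fun z hz => ?_) s .refl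
      by_cases hc : G.ctrl z = i
      · rw [playFun_comb_self _ _ _ _ hc]; exact (hfQ z).ge
      · exact (hbel.2 z hc).1 _ (hmem fi τo z hz)
  · exact h.E_le hw (G.mkProfile f hfact) (fun _ => True) (fun _ _ _ _ => trivial) (fun z _ => (hfQ z).le) s trivial
  · exact h.le_E hw (G.mkProfile f hfact) (fun _ => True) (fun _ _ _ _ => trivial) (fun z _ => (hfQ z).ge) s trivial

theorem GoodE.rval_bellman (h : G.GoodE u E) {B : S → Set A} (hB : ∀ z, B z ⊆ G.act z)
    (hB' : ∀ z, (B z).Nonempty) (i : N) :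
    G.Within (u i) (fun s => G.rval E B s i) ∧ G.Bellman B i (fun s => G.rval E B s i) ∧
      ∃ τ : G.Profile, (∀ z, G.playFun τ z ∈ B z) ∧ ∀ s, E τ s i = G.rval E B s i := by
  obtain ⟨C, hC⟩ := h.bdd i
  obtain ⟨w, h1, h2⟩ := G.exists_bellman hC B hB hB' i
  obtain ⟨h3, h4⟩ := h.rval_eq hB h1 h2
  have : (fun s => G.rval E B s i) = w := funext h3
  rw [this]
  refine ⟨h1, h2, ?_⟩
  obtain ⟨τ, h5, h6⟩ := h4
  exact ⟨τ, h5, fun s => by rw [h6, h3]⟩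

theorem mem_Ak_succ (k : ℕ) (s : S) (a : A) : a ∈ G.Ak E (k + 1) s ↔ a ∈ G.Ak E k s ∧
    G.Q (fun z => G.rval E (G.Ak E k) z (G.ctrl s)) s a = G.rval E (G.Ak E k) s (G.ctrl s) :=
  Iff.rfl

theorem GoodE.Ak_good (h : G.GoodE u E) (k : ℕ) : (∀ z, G.Ak E k z ⊆ G.act z) ∧ ∀ z, (G.Ak E k z).Nonempty := by
  induction k with
  | zero => exact ⟨fun z => subset_rfl, fun z => G.act_nonempty z⟩
  | succ k ih =>
    refine ⟨fun z a ha => ih.1 z ((mem_Ak_succ k z a).mp ha).1, fun z => ?_⟩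
    obtain ⟨_, h2, _⟩ := h.rval_bellman ih.1 ih.2 (G.ctrl z)
    obtain ⟨a, ha, ha2⟩ := (h2.1 z rfl).2
    exact ⟨a, (mem_Ak_succ k z a).mpr ⟨ha, ha2⟩⟩

theorem GoodE.rval_le_E (h : G.GoodE u E) (k : ℕ) (i : N) (τ : G.Profile) (R : S → Prop)
    (hR : ∀ z, R z → ∀ z' ∈ (G.q z (G.playFun τ z)).support, R z')
    (hD : ∀ z, R z → G.playFun τ z ∈ G.Ak E (k + 1) z) (s : S) (hs : R s) :
    G.rval E (G.Ak E k) s i ≤ E τ s i := by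
  obtain ⟨g1, g2⟩ := h.Ak_good k
  obtain ⟨h1, h2, _⟩ := h.rval_bellman g1 g2 i
  refine h.le_E h1 τ R hR (fun z hz => ?_) s hs
  have hm := (mem_Ak_succ k z _).mp (hD z hz)
  by_cases hc : G.ctrl z = i
  · subst hc; exact hm.2.ge
  · exact (h2.2 z hc).1 _ hm.1

theorem GoodE.rval_mono (h : G.GoodE u E) (i : N) (s : S) : Monotone (fun k => G.rval E (G.Ak E k) s i) := by
  refine monotone_nat_of_le_succ fun k => ?_
  obtain ⟨g1, g2⟩ := h.Ak_good (k + 1)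
  obtain ⟨_, _, τ, h3, h4⟩ := h.rval_bellman g1 g2 i
  rw [← h4 s]
  exact h.rval_le_E k i τ (fun _ => True) (fun _ _ _ _ => trivial) (fun z _ => h3 z) s trivial

theorem Ak_anti (s : S) : Antitone (fun k => G.Ak E k s) :=
  antitone_nat_of_succ_le fun k _ ha => ((mem_Ak_succ k s _).mp ha).1

theorem GoodE.limit_bellman (h : G.GoodE u E) (i : N) : ∃ w : S → ℝ,
    (∀ s, Tendsto (fun k => G.rval E (G.Ak E k) s i) atTop (𝓝 (w s))) ∧
    G.Within (u i) w ∧ G.Bellman (G.Ainf E) i w ∧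
    (∀ z, G.ctrl z = i → ∀ a ∈ G.Ainf E z, G.Q w z a = w z) := by
  obtain ⟨C, hC⟩ := h.bdd i
  have hW : ∀ k, G.Within (u i) (fun s => G.rval E (G.Ak E k) s i) := fun k =>
    (h.rval_bellman (h.Ak_good k).1 (h.Ak_good k).2 i).1
  have hBel : ∀ k, G.Bellman (G.Ak E k) i (fun s => G.rval E (G.Ak E k) s i) := fun k =>
    (h.rval_bellman (h.Ak_good k).1 (h.Ak_good k).2 i).2.1
  have hb : ∀ k s, |G.rval E (G.Ak E k) s i| ≤ C := fun k s => (hW k).bdd hC s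
  have hlim : ∀ s, Tendsto (fun k => G.rval E (G.Ak E k) s i) atTop
      (𝓝 (⨆ k, G.rval E (G.Ak E k) s i)) := fun s =>
    tendsto_atTop_ciSup (h.rval_mono i s) ⟨C, by
      rintro _ ⟨k, rfl⟩; exact (abs_le.mp (hb k s)).2⟩
  obtain ⟨w, hlim⟩ : ∃ w : S → ℝ, ∀ s, Tendsto (fun k => G.rval E (G.Ak E k) s i) atTop
      (𝓝 (w s)) := ⟨_, hlim⟩
  have hQlim : ∀ z a, Tendsto (fun k => G.Q (fun s => G.rval E (G.Ak E k) s i) z a) atTop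
      (𝓝 (G.Q w z a)) := by
    intro z a
    refine tendsto_tsum_of_dominated_convergence (bound := fun x => (G.q z a x).toReal * C)
      ((G.q_hasSum z a).summable.mul_right C) (fun x => (hlim x).const_mul _)
      (Eventually.of_forall fun k x => ?_)
    rw [norm_mul, Real.norm_of_nonneg ENNReal.toReal_nonneg]
    exact mul_le_mul_of_nonneg_left (hb k x) ENNReal.toReal_nonneg
  have hself : ∀ z, G.ctrl z = i → ∀ a ∈ G.Ainf E z, G.Q w z a = w z := by
    intro z hz a ha
    refine tendsto_nhds_unique (hQlim z a) ((hlim z).congr fun k => ?_)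
    have := ((mem_Ak_succ k z a).mp (Set.mem_iInter.mp ha (k + 1))).2
    rw [hz] at this
    exact this.symm
  have hexists : ∀ z, ∃ a ∈ G.Ainf E z, G.Q w z a = w z := by
    intro z
    have h1 : ∀ k, ∃ a ∈ G.act z, a ∈ G.Ak E k z ∧
        G.Q (fun s => G.rval E (G.Ak E k) s i) z a = G.rval E (G.Ak E k) z i := by
      intro k
      by_cases hz : G.ctrl z = i
      · obtain ⟨a, ha, ha2⟩ := ((hBel k).1 z hz).2
        exact ⟨a, (h.Ak_good k).1 z ha, ha, ha2⟩
      · obtain ⟨a, ha, ha2⟩ := ((hBel k).2 z hz).2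
        exact ⟨a, (h.Ak_good k).1 z ha, ha, ha2⟩
    have h2 : ∃ a ∈ G.act z, ∃ᶠ k in atTop, a ∈ G.Ak E k z ∧
        G.Q (fun s => G.rval E (G.Ak E k) s i) z a = G.rval E (G.Ak E k) z i := by
      by_contra hcon
      push Not at hcon
      have h3 := (Filter.eventually_all_finset (G.act z)).mpr hcon
      obtain ⟨k, hk⟩ := h3.exists
      obtain ⟨a, ha, ha1, ha2⟩ := h1 k
      exact hk a ha ha1 ha2
    obtain ⟨a, _, ha⟩ := h2
    refine ⟨a, Set.mem_iInter.mpr fun k => ?_, ?_⟩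
    · obtain ⟨m, hm, hm2⟩ := (Filter.frequently_atTop.mp ha) k
      exact Ak_anti z hm hm2.1
    · by_contra hne
      have h4 := ((hQlim z a).sub (hlim z)).eventually_ne (sub_ne_zero.mpr hne)
      obtain ⟨k, hk, hk2⟩ := (ha.and_eventually h4).exists
      exact hk2 (sub_eq_zero.mpr hk.2)
  refine ⟨w, hlim, ?_, ⟨fun z hz => ⟨fun a ha => (hself z hz a ha).le, hexists z⟩,
    fun z hz => ⟨fun a ha => ?_, hexists z⟩⟩, hself⟩
  · intro s a b hab
    exact ⟨ge_of_tendsto' (hlim s) fun k => (hW k s a b hab).1,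
      le_of_tendsto' (hlim s) fun k => (hW k s a b hab).2⟩
  · exact le_of_tendsto_of_tendsto' (hlim z) (hQlim z a) fun k =>
      ((hBel k).2 z hz).1 a (Set.mem_iInter.mp ha k)

theorem GoodE.main (h : G.GoodE u E) :
    (∀ s ∈ G.Sinf E, ∀ a ∈ G.Ainf E s,
        G.rval E (G.Ainf E) s (G.ctrl s) = G.rvalQ E (G.Ainf E) s a (G.ctrl s)) ∧
    (∀ τ : G.Profile, (∀ s ∈ G.Sinf E, G.playFun τ s ∈ G.Ainf E s) →
        ∀ (i : N), ∀ s ∈ G.Sinf E, G.rval E (G.Ainf E) s i ≤ E τ s i) := by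
  have hsub : ∀ z, G.Ainf E z ⊆ G.act z := fun z a ha => (h.Ak_good 0).1 z (Set.mem_iInter.mp ha 0)
  constructor
  · intro s _ a ha
    obtain ⟨w, _, h2, h3, h4⟩ := h.limit_bellman (G.ctrl s)
    have h5 := (h.rval_eq hsub h2 h3).1
    have h6 : (fun s' => G.rval E (G.Ainf E) s' (G.ctrl s)) = w := funext h5
    change _ = G.Q (fun s' => G.rval E (G.Ainf E) s' (G.ctrl s)) s a
    rw [h6, h5, h4 s rfl a ha]
  · intro τ hτ i s hs
    obtain ⟨w, h1, h2, h3, _⟩ := h.limit_bellman i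
    rw [(h.rval_eq hsub h2 h3).1 s]
    refine le_of_tendsto' (h1 s) fun k => ?_
    refine h.rval_le_E k i τ (fun z => z ∈ G.Sinf E) (fun z hz z' hz' => ?_)
      (fun z hz => Set.mem_iInter.mp (hτ z hz) (k + 1)) s hs
    refine Set.mem_iInter.mpr fun m => ?_
    have h5 : Relation.ReflTransGen (G.stepIn (G.Ak E m)) G.init z := Set.mem_iInter.mp hz m
    exact h5.tail ⟨_, Set.mem_iInter.mp (hτ z hz) m, hz'⟩

end Values

end PGame


/-- **Properties of the limit game `G^∞`** (Lemma 5): in a multi-player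
perfect-information game with probabilistic transitions, countable state space,
nonempty finite action sets, and bounded continuous payoff functions:
(a) every action is optimal in `G^∞`, i.e. for every state `s ∈ S^∞` and every
action `a ∈ A^∞(s)` one has `v^∞_{i(s)}(s) = ∑_{z ∈ S(s,a)} q(s,a)(z)·v^∞_{i(s)}(z)`;
and (b) every strategy profile `τ` playing only actions of `G^∞` satisfies
`u_i(τ|s) ≥ v^∞_i(s)` for every player `i` and every state `s ∈ S^∞`. -/
theorem limit_game_properties
    {N S A : Type*} [Finite N] [Countable S]
    (hN : 2 ≤ Nat.card N)
    (G : PGame N S A) (u : N → G.Play → ℝ)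
    (hu_bdd : ∀ i : N, ∃ C : ℝ, ∀ p : G.Play, |u i p| ≤ C)
    (hu_cont : ∀ i : N, Continuous (u i))
    (μ : G.Profile → MeasureTheory.Measure G.Play)
    (hμ : G.IsInducedMeasure μ)
    (E : G.Profile → S → N → ℝ)
    (hE : G.IsSubgamePayoff μ u E) :
    (∀ s ∈ G.Sinf E, ∀ a ∈ G.Ainf E s,
        G.rval E (G.Ainf E) s (G.ctrl s) = G.rvalQ E (G.Ainf E) s a (G.ctrl s)) ∧
    (∀ τ : G.Profile, (∀ s ∈ G.Sinf E, G.playFun τ s ∈ G.Ainf E s) →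
        ∀ (i : N), ∀ s ∈ G.Sinf E, G.rval E (G.Ainf E) s i ≤ E τ s i) := by
  exact PGame.GoodE.main (u := u) ⟨hu_bdd, hu_cont,
    fun σ i s a b h => G.E_within hμ hu_bdd hu_cont hE σ s i a b h,
    fun σ s i => G.E_step hμ hu_bdd hu_cont hE σ s i⟩
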